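/- Let q be a power of an odd prime and let c ∈ F_q be nonzero. Then the cardinality of QR(q) ∩ {x + c : x ∈ QR(q)} equals (q+3)/4 if both -1 and c are quadratic residues; equals (q-1)/4 if -1 is a quadratic residue and c is not; and equals (q+1)/4 otherwise. -/

import Mathlib

open scoped Classical

theorem aux_jac {F : Type*} [Field F] [Fintype F] (h2 : ringChar F ≠ 2) (c : F) (hc : c ≠ 0) :
    ∑ x : F, quadraticChar F x * quadraticChar F (x - c) = -1 := by
  have h := jacobiSum_nontrivial_inv (quadraticChar_ne_one h2)
  have hi : (quadraticChar F)⁻¹ = quadraticChar F := (quadraticChar_isQuadratic F).inv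
  rw [hi, jacobiSum] at h
  rw [← Equiv.sum_comp (Equiv.mulLeft₀ c hc)]
  have hc2 : quadraticChar F c * quadraticChar F c = 1 := by
    have := quadraticChar_sq_one hc
    rwa [sq] at this
  have hm : quadraticChar F (-1) * quadraticChar F (-1) = 1 := by
    have := quadraticChar_sq_one (neg_ne_zero.mpr (one_ne_zero (α := F)))
    rwa [sq] at this
  have key : ∀ y : F, quadraticChar F (Equiv.mulLeft₀ c hc y) *
      quadraticChar F (Equiv.mulLeft₀ c hc y - c) =
      quadraticChar F (-1) * (quadraticChar F y * quadraticChar F (1 - y)) := by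
    intro y
    have e : Equiv.mulLeft₀ c hc y - c = c * (-1 * (1 - y)) := by
      simp only [Equiv.mulLeft₀_apply]; ring
    rw [e, Equiv.mulLeft₀_apply, map_mul, map_mul, map_mul]
    linear_combination (quadraticChar F (-1) * (quadraticChar F y * quadraticChar F (1 - y))) * hc2
  rw [Finset.sum_congr rfl (fun y _ => key y), ← Finset.mul_sum, h]
  linear_combination -hm

theorem aux_sum {F : Type*} [Field F] [Fintype F] (h2 : ringChar F ≠ 2) (c : F) (hc : c ≠ 0) :
    4 * ((Finset.univ.filter (fun x : F => IsSquare x ∧ IsSquare (x - c))).card : ℤ) =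
      Fintype.card F + 1 + quadraticChar F c + quadraticChar F (-c) := by
  rw [Finset.card_filter]
  push_cast
  rw [Finset.mul_sum]
  have key : ∀ x : F, 4 * (if IsSquare x ∧ IsSquare (x - c) then (1:ℤ) else 0) =
      1 + quadraticChar F x + quadraticChar F (x - c)
      + quadraticChar F x * quadraticChar F (x - c)
      + (if x = 0 then 1 + quadraticChar F (-c) else 0)
      + (if x = c then 1 + quadraticChar F c else 0) := by
    intro x
    simp only [quadraticChar_apply, quadraticCharFun]
    by_cases hx : x = 0
    · subst hx
      have : -c ≠ 0 := neg_ne_zero.mpr hc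
      by_cases h : IsSquare (-c) <;> simp [h, hc, hc.symm]
    · by_cases hxc : x = c
      · subst hxc
        by_cases h : IsSquare x <;> simp [h, hc]
      · have : x - c ≠ 0 := sub_ne_zero.mpr hxc
        by_cases h : IsSquare x <;> by_cases h' : IsSquare (x - c) <;> simp [h, h', hx, hxc, this]
  rw [Finset.sum_congr rfl (fun y _ => key y)]
  simp only [Finset.sum_add_distrib, Finset.sum_ite_eq', Finset.mem_univ, if_true]
  have hs : ∑ x : F, quadraticChar F (x - c) = 0 := by
    rw [← quadraticChar_sum_zero h2]
    exact Equiv.sum_comp (Equiv.subRight c) (fun x => quadraticChar F x)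
  rw [aux_jac h2 c hc, hs, quadraticChar_sum_zero h2]
  simp
  ring

/-- For a finite field `F` of odd order `q` and `0 ≠ c ∈ F`, the number of
quadratic residues which are of the form (quadratic residue) + `c` is
`(q+3)/4` if `-1` and `c` are both quadratic residues, `(q-1)/4` if `-1` is a
quadratic residue but `c` is not, and `(q+1)/4` otherwise. -/
theorem stmt_3 (p n : ℕ) (hp : p.Prime) (hodd : Odd p) (hn : 0 < n)
    (F : Type*) [Field F] [Fintype F] (hF : Fintype.card F = p ^ n)
    (c : F) (hc : c ≠ 0) :
    Nat.card ({x : F | ∃ y : F, y ^ 2 = x} ∩ {x : F | ∃ y : F, (∃ z : F, z ^ 2 = y) ∧ x = y + c} : Set F) =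
      if (∃ u : F, u ^ 2 = -1) ∧ (∃ v : F, v ^ 2 = c) then (p ^ n + 3) / 4
      else if (∃ u : F, u ^ 2 = -1) ∧ ¬ (∃ v : F, v ^ 2 = c) then (p ^ n - 1) / 4
      else (p ^ n + 1) / 4 := by
  have h2 : ringChar F ≠ 2 := by
    intro h
    have := FiniteField.even_card_of_char_two h
    have h3 : Odd (Fintype.card F) := hF ▸ hodd.pow
    rw [Nat.odd_iff] at h3
    omega
  have hset : ({x : F | ∃ y : F, y ^ 2 = x} ∩
      {x : F | ∃ y : F, (∃ z : F, z ^ 2 = y) ∧ x = y + c} : Set F) =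
      ((Finset.univ.filter (fun x : F => IsSquare x ∧ IsSquare (x - c)) : Finset F) : Set F) := by
    ext x
    simp only [Set.mem_inter_iff, Set.mem_setOf_eq, Finset.coe_filter, Finset.mem_univ, true_and,
      isSquare_iff_exists_sq]
    constructor
    · rintro ⟨⟨y, hy⟩, _, ⟨z, rfl⟩, hz⟩
      exact ⟨⟨y, hy.symm⟩, z, by rw [hz]; ring⟩
    · rintro ⟨⟨y, hy⟩, z, hz⟩
      exact ⟨⟨y, hy.symm⟩, z ^ 2, ⟨z, rfl⟩, by rw [← hz]; ring⟩
  have hsum := aux_sum h2 c hc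
  rw [hset, Nat.card_coe_set_eq, Set.ncard_coe_finset]
  have hsq : ∀ a : F, (∃ u : F, u ^ 2 = a) ↔ IsSquare a := by
    intro a
    simp only [isSquare_iff_exists_sq, eq_comm]
  simp only [hsq]
  rw [hF] at hsum
  have hmul : quadraticChar F (-c) = quadraticChar F (-1) * quadraticChar F c := by
    rw [← map_mul]; congr 1; ring
  rw [hmul] at hsum
  have h1 : (-1 : F) ≠ 0 := neg_ne_zero.mpr one_ne_zero
  generalize (Finset.univ.filter (fun x : F => IsSquare x ∧ IsSquare (x - c))).card = N at *
  simp only [quadraticChar_apply, quadraticCharFun, hc, h1, if_false] at hsum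
  have hpos : 0 < p ^ n := pow_pos hp.pos n
  generalize p ^ n = q at *
  by_cases ha : IsSquare (-1 : F) <;> by_cases hb : IsSquare c <;>
    simp only [ha, hb, if_true, if_false, not_true, not_false_iff, and_true, and_false,
      true_and, false_and] at hsum ⊢ <;> omega
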